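/- With notation as in the Gulliksen–Negård complex: for a t×t matrix A over R inducing φ: F → G with I_A = I_{t-1}(A) of codimension 4, the sequence ker[Hom(F,F) ⊕ Hom(G,G) --j--> R] → Hom(F,G) → I_A(s) → 0 is exact, where j(ρ_0, ρ_1) = tr(ρ_0) - tr(ρ_1), the map Hom(F,G) → I_A(s) sends γ to tr(γψ) with ψ the adjugate (cofactor) matrix of A, and the first map sends (ρ_0, ρ_1) to ρ_1 φ - φ ρ_0. -/

import Mathlib

open MvPolynomial CategoryTheory

/-- Homogeneity of integer degree `d` (zero if `d < 0`). -/
def IsHomogZ {σ : Type*} {k : Type*} [CommSemiring k]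
    (p : MvPolynomial σ k) (d : ℤ) : Prop :=
  if 0 ≤ d then p.IsHomogeneous d.toNat else p = 0

/-- The codimension (height) of an ideal: the infimum of the heights of the
minimal primes over it. -/
noncomputable def idealCodim {R : Type*} [CommRing R] (I : Ideal R) : ℕ∞ :=
  ⨅ (P : PrimeSpectrum R) (_ : P.asIdeal ∈ I.minimalPrimes), Order.height P

open Polynomial in
theorem Matrix.exists_linearMap_adjugate {R n : Type*} [CommRing R] [Fintype n] [DecidableEq n]
    (A : Matrix n n R) :
    ∃ P : Matrix n n R →ₗ[R] Matrix n n R,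
      (∀ X, A * P X + X * A.adjugate = (A.adjugate * X).trace • (1 : Matrix n n R)) ∧
      ∀ X, P X * A + A.adjugate * X = (A.adjugate * X).trace • (1 : Matrix n n R) := by
  have key (b a : n) : ∃ Q : Matrix n n R,
      A * Q + Matrix.single b a 1 * A.adjugate = A.adjugate a b • (1 : Matrix n n R) ∧
      Q * A + A.adjugate * Matrix.single b a 1 = A.adjugate a b • (1 : Matrix n n R) := by
    let E : Matrix n n R := Matrix.single b a 1
    let B : Matrix n n R[X] := A.map Polynomial.C + (Polynomial.X : R[X]) • E.map Polynomial.C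
    have hB0 : B.map (evalRingHom 0) = A := by
      ext i j; simp [B]
    have hdet : B.det = Polynomial.C A.det + Polynomial.X * Polynomial.C (A.adjugate a b) := by
      have hB : B = (A.map Polynomial.C).updateRow b
          ((A.map Polynomial.C) b + (Polynomial.X : R[X]) • Pi.single a 1) := by
        ext i j
        by_cases hi : i = b
        · subst hi
          by_cases hj : j = a
          · subst hj; simp [B, E]
          · simp [B, E, hj, Ne.symm hj]
        · simp [B, E, hi, Ne.symm hi]
      rw [hB, Matrix.det_updateRow_add, Matrix.det_updateRow_smul, Matrix.updateRow_eq_self,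
        ← Matrix.adjugate_apply]
      have h1 := RingHom.map_det (Polynomial.C : R →+* R[X]) A
      have h2 := RingHom.map_adjugate (Polynomial.C : R →+* R[X]) A
      rw [RingHom.mapMatrix_apply] at h1
      rw [RingHom.mapMatrix_apply, RingHom.mapMatrix_apply] at h2
      rw [h1, ← h2, Matrix.map_apply]
    have hadj (i j : n) : (B.adjugate i j).coeff 0 = A.adjugate i j := by
      have h2 := RingHom.map_adjugate (evalRingHom (0 : R)) B
      rw [RingHom.mapMatrix_apply, RingHom.mapMatrix_apply, hB0] at h2
      rw [← h2, Matrix.map_apply, coeff_zero_eq_eval_zero]; rfl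
    refine ⟨B.adjugate.map fun p => p.coeff 1, ?_, ?_⟩
    · have h := Matrix.mul_adjugate B
      ext i j
      have h' := congrArg (fun p => p.coeff 1) (congrFun (congrFun h i) j)
      rw [hdet] at h'
      have e : (((Polynomial.C A.det + Polynomial.X * Polynomial.C (A.adjugate a b)) •
            (1 : Matrix n n R[X])) i j).coeff 1 =
          (A.adjugate a b • (1 : Matrix n n R)) i j := by
        by_cases hij : i = j
        · subst hij; simp
        · simp [hij]
      rw [← e, ← h']
      simp only [Matrix.mul_apply, Matrix.add_apply, Matrix.map_apply, Polynomial.finsetSum_coeff,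
        B, Matrix.smul_apply, smul_eq_mul, add_mul, Polynomial.coeff_add, Polynomial.coeff_C_mul,
        mul_assoc, Polynomial.coeff_X_mul, Finset.sum_add_distrib]
      simp [← hadj, B, E]
    · have h := Matrix.adjugate_mul B
      ext i j
      have h' := congrArg (fun p => p.coeff 1) (congrFun (congrFun h i) j)
      rw [hdet] at h'
      have e : (((Polynomial.C A.det + Polynomial.X * Polynomial.C (A.adjugate a b)) •
            (1 : Matrix n n R[X])) i j).coeff 1 =
          (A.adjugate a b • (1 : Matrix n n R)) i j := by
        by_cases hij : i = j
        · subst hij; simp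
        · simp [hij]
      rw [← e, ← h']
      simp only [Matrix.mul_apply, Matrix.add_apply, Matrix.map_apply, Polynomial.finsetSum_coeff,
        B, Matrix.smul_apply, smul_eq_mul, mul_add, Polynomial.coeff_add, Polynomial.coeff_mul_C,
        Finset.sum_add_distrib, mul_left_comm _ Polynomial.X, Polynomial.coeff_X_mul]
      simp [← hadj, B, E]
  choose Q h1 h2 using key
  have htr (X : Matrix n n R) : (A.adjugate * X).trace = ∑ b, ∑ a, X b a * A.adjugate a b := by
    simp only [Matrix.trace, Matrix.diag, Matrix.mul_apply]
    rw [Finset.sum_comm]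
    simp_rw [mul_comm]
  have hX (X : Matrix n n R) : X = ∑ b, ∑ a, X b a • Matrix.single b a (1 : R) := by
    conv_lhs => rw [Matrix.matrix_eq_sum_single X]
    simp [Matrix.smul_single]
  refine ⟨∑ b, ∑ a, (LinearMap.toSpanSingleton R _ (Q b a)).comp
    (Matrix.entryLinearMap R R b a), fun X => ?_, fun X => ?_⟩
  · rw [htr]
    conv_lhs => enter [2]; rw [hX X]
    simp only [LinearMap.sum_apply, LinearMap.comp_apply, Matrix.entryLinearMap_apply,
      LinearMap.toSpanSingleton_apply, Finset.mul_sum, Finset.sum_mul, ← Finset.sum_add_distrib,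
      Finset.sum_smul, Matrix.mul_smul, Matrix.smul_mul, ← smul_add, h1, mul_smul]
  · rw [htr]
    conv_lhs => enter [2]; rw [hX X]
    simp only [LinearMap.sum_apply, LinearMap.comp_apply, Matrix.entryLinearMap_apply,
      LinearMap.toSpanSingleton_apply, Finset.mul_sum, Finset.sum_mul, ← Finset.sum_add_distrib,
      Finset.sum_smul, Matrix.mul_smul, Matrix.smul_mul, ← smul_add, h2, mul_smul]
/-- `P` is a directional derivative of `Matrix.adjugate` at `A`, as characterised by the product
rules obtained from differentiating `A * adj A = det A`, `adj (B * A) = adj A * adj B` and the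
symmetry of the second derivative of the determinant. -/
structure Matrix.IsAdjugateDeriv {R n : Type*} [CommRing R] [Fintype n] [DecidableEq n]
    (A : Matrix n n R) (P : Matrix n n R →ₗ[R] Matrix n n R) : Prop where
  mul_apply_add (X) : A * P X + X * A.adjugate = (A.adjugate * X).trace • (1 : Matrix n n R)
  apply_mul_add (X) : P X * A + A.adjugate * X = (A.adjugate * X).trace • (1 : Matrix n n R)
  apply_mul_right (S) : P (S * A) = A.adjugate * (S.trace • (1 : Matrix n n R) - S)
  apply_mul_left (T) : P (A * T) = (T.trace • (1 : Matrix n n R) - T) * A.adjugate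
  trace_mul (X Y) : (P X * Y).trace = (X * P Y).trace

theorem Matrix.mul_left_cancel_of_det_mem_nonZeroDivisors {R n : Type*} [CommRing R] [Fintype n]
    [DecidableEq n] {A B C : Matrix n n R} (hA : A.det ∈ nonZeroDivisors R)
    (h : A * B = A * C) : B = C := by
  have h' := congrArg (A.adjugate * ·) h
  simp only [← Matrix.mul_assoc, Matrix.adjugate_mul, Matrix.smul_mul, Matrix.one_mul] at h'
  ext i j
  have := congrFun (congrFun h' i) j
  simp only [Matrix.smul_apply, smul_eq_mul] at this
  exact (mul_cancel_left_mem_nonZeroDivisors hA).mp this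

theorem Matrix.mul_right_cancel_of_det_mem_nonZeroDivisors {R n : Type*} [CommRing R] [Fintype n]
    [DecidableEq n] {A B C : Matrix n n R} (hA : A.det ∈ nonZeroDivisors R)
    (h : B * A = C * A) : B = C := by
  have h' := congrArg (· * A.adjugate) h
  simp only [Matrix.mul_assoc, Matrix.mul_adjugate, Matrix.mul_smul, Matrix.mul_one] at h'
  ext i j
  have := congrFun (congrFun h' i) j
  simp only [Matrix.smul_apply, smul_eq_mul] at this
  exact (mul_cancel_left_mem_nonZeroDivisors hA).mp this

theorem Matrix.exists_isAdjugateDeriv_of_det_mem_nonZeroDivisors {R n : Type*} [CommRing R]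
    [Fintype n] [DecidableEq n] (A : Matrix n n R) (hA : A.det ∈ nonZeroDivisors R) :
    ∃ P, A.IsAdjugateDeriv P := by
  obtain ⟨P, h1, h2⟩ := A.exists_linearMap_adjugate
  have h3 (X Y : Matrix n n R) : A.det * (P X * Y).trace =
      (A.adjugate * X).trace * (A.adjugate * Y).trace -
        (A.adjugate * X * A.adjugate * Y).trace := by
    have := congrArg (fun M => (A.adjugate * M * Y).trace) (h1 X)
    simp only [Matrix.mul_add, Matrix.add_mul, ← Matrix.mul_assoc, Matrix.adjugate_mul,
      Matrix.smul_mul, Matrix.one_mul, Matrix.mul_smul, Matrix.mul_one, Matrix.trace_add,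
      Matrix.trace_smul, smul_eq_mul] at this
    rw [← this]; ring
  refine ⟨P, h1, h2, fun S => ?_, fun T => ?_, fun X Y => ?_⟩
  · apply Matrix.mul_left_cancel_of_det_mem_nonZeroDivisors hA
    have := h1 (S * A)
    rw [← Matrix.mul_assoc, Matrix.mul_adjugate, Matrix.smul_mul, Matrix.one_mul]
    rw [Matrix.mul_assoc, Matrix.mul_adjugate, ← Matrix.mul_assoc, Matrix.trace_mul_comm,
      ← Matrix.mul_assoc, Matrix.mul_adjugate] at this
    rw [eq_sub_of_add_eq this]
    simp [smul_sub, smul_smul]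
  · apply Matrix.mul_right_cancel_of_det_mem_nonZeroDivisors hA
    have := h2 (A * T)
    rw [Matrix.mul_assoc, Matrix.adjugate_mul, Matrix.mul_smul, Matrix.mul_one]
    rw [← Matrix.mul_assoc, Matrix.adjugate_mul] at this
    rw [eq_sub_of_add_eq this]
    simp [smul_sub, smul_smul]
  · apply (mul_cancel_left_mem_nonZeroDivisors hA).mp
    rw [Matrix.trace_mul_comm X, h3, h3, mul_comm, Matrix.mul_assoc (A.adjugate * X),
      Matrix.trace_mul_comm (A.adjugate * X), ← Matrix.mul_assoc]

open Polynomial in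
theorem Matrix.exists_isAdjugateDeriv {R n : Type*} [CommRing R] [Fintype n] [DecidableEq n]
    (A : Matrix n n R) : ∃ P, A.IsAdjugateDeriv P := by
  let B : Matrix n n R[X] := (-A).charmatrix
  have hB : B.det ∈ nonZeroDivisors R[X] := (Matrix.charpoly_monic (-A)).mem_nonZeroDivisors
  obtain ⟨P, hP⟩ := B.exists_isAdjugateDeriv_of_det_mem_nonZeroDivisors hB
  let ev : Matrix n n R[X] →+* Matrix n n R := (evalRingHom 0).mapMatrix
  let c : Matrix n n R →+* Matrix n n R[X] := Polynomial.C.mapMatrix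
  have hev (p : R[X]) (M : Matrix n n R[X]) : ev (p • M) = p.eval 0 • ev M := by
    ext i j; simp [ev]
  have hc (r : R) (M : Matrix n n R) : c (r • M) = Polynomial.C r • c M := by
    ext i j; simp [c]
  have hevc (M : Matrix n n R) : ev (c M) = M := by
    ext i j; simp [ev, c]
  have hBA : ev B = A := by
    ext i j
    by_cases hij : i = j
    · subst hij; simp [ev, B, Matrix.charmatrix_apply_eq]
    · simp [ev, B, Matrix.charmatrix_apply_ne _ _ _ hij]
  have hadj : ev B.adjugate = A.adjugate := by rw [RingHom.map_adjugate, ← hBA]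
  have hBc : B = c A + (Polynomial.X : R[X]) • 1 := by
    ext i j
    by_cases hij : i = j
    · subst hij; simp [B, c, Matrix.charmatrix_apply_eq, add_comm]
    · simp [B, c, hij]
  have hctr (M : Matrix n n R) : (c M).trace = Polynomial.C M.trace :=
    (AddMonoidHom.map_trace (Polynomial.C : R →+* R[X]) M).symm
  have htr (M : Matrix n n R[X]) : M.trace.eval 0 = (ev M).trace :=
    AddMonoidHom.map_trace (evalRingHom (0 : R)) M
  refine ⟨{ toFun := fun X => ev (P (c X)), map_add' := by simp, map_smul' := ?_ }, ?_⟩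
  · intro r X; simp [hc, hev]
  · constructor
    · intro X
      simpa [hBA, hadj, hev, htr, hevc] using congrArg ev (hP.mul_apply_add (c X))
    · intro X
      simpa [hBA, hadj, hev, htr, hevc] using congrArg ev (hP.apply_mul_add (c X))
    · intro S
      have h := congrArg ev (hP.apply_mul_right (c S))
      simpa [hBc ▸ hadj, hBc, mul_add, hev, hctr, hevc] using h
    · intro T
      have h := congrArg ev (hP.apply_mul_left (c T))
      simpa [hBc ▸ hadj, hBc, add_mul, hev, hctr, hevc] using h
    · intro X Y
      simpa [htr, hevc] using congrArg (Polynomial.eval 0) (hP.trace_mul (c X) (c Y))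
/-- Elementwise form of weak regularity on `M` of a sequence of four elements. -/
structure IsWeaklyRegularFour {R : Type*} [CommRing R] (f : Fin 4 → R) (M : Type*)
    [AddCommGroup M] [Module R M] : Prop where
  eq_zero (x : M) : f 0 • x = 0 → x = 0
  exists_one (x y : M) : f 1 • x = f 0 • y → ∃ z, x = f 0 • z
  exists_two (x y₀ y₁ : M) : f 2 • x = f 0 • y₀ + f 1 • y₁ → ∃ z₀ z₁, x = f 0 • z₀ + f 1 • z₁
  exists_three (x y₀ y₁ y₂ : M) : f 3 • x = f 0 • y₀ + f 1 • y₁ + f 2 • y₂ →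
    ∃ z₀ z₁ z₂, x = f 0 • z₀ + f 1 • z₁ + f 2 • z₂

namespace IsWeaklyRegularFour

variable {R : Type*} [CommRing R] {f : Fin 4 → R} {M N : Type*} [AddCommGroup M] [Module R M]
  [AddCommGroup N] [Module R N]

theorem pi {ι : Type*} (h : IsWeaklyRegularFour f M) : IsWeaklyRegularFour f (ι → M) where
  eq_zero x hx := funext fun i => h.eq_zero _ (congrFun hx i)
  exists_one x y hx := by
    choose z hz using fun i => h.exists_one _ _ (congrFun hx i)
    exact ⟨z, funext hz⟩
  exists_two x y₀ y₁ hx := by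
    choose z₀ z₁ hz using fun i => h.exists_two _ _ _ (congrFun hx i)
    exact ⟨z₀, z₁, funext hz⟩
  exists_three x y₀ y₁ y₂ hx := by
    choose z₀ z₁ z₂ hz using fun i => h.exists_three _ _ _ _ (congrFun hx i)
    exact ⟨z₀, z₁, z₂, funext hz⟩

theorem prod (hM : IsWeaklyRegularFour f M) (hN : IsWeaklyRegularFour f N) :
    IsWeaklyRegularFour f (M × N) where
  eq_zero x hx := Prod.ext (hM.eq_zero _ (congrArg Prod.fst hx))
    (hN.eq_zero _ (congrArg Prod.snd hx))
  exists_one x y hx := by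
    obtain ⟨z, hz⟩ := hM.exists_one _ _ (congrArg Prod.fst hx)
    obtain ⟨w, hw⟩ := hN.exists_one _ _ (congrArg Prod.snd hx)
    exact ⟨(z, w), Prod.ext hz hw⟩
  exists_two x y₀ y₁ hx := by
    obtain ⟨z₀, z₁, hz⟩ := hM.exists_two _ _ _ (congrArg Prod.fst hx)
    obtain ⟨w₀, w₁, hw⟩ := hN.exists_two _ _ _ (congrArg Prod.snd hx)
    exact ⟨(z₀, w₀), (z₁, w₁), Prod.ext hz hw⟩
  exists_three x y₀ y₁ y₂ hx := by
    obtain ⟨z₀, z₁, z₂, hz⟩ := hM.exists_three _ _ _ _ (congrArg Prod.fst hx)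
    obtain ⟨w₀, w₁, w₂, hw⟩ := hN.exists_three _ _ _ _ (congrArg Prod.snd hx)
    exact ⟨(z₀, w₀), (z₁, w₁), (z₂, w₂), Prod.ext hz hw⟩

/-- Exactness of the Koszul cochain complex in degree one. -/
theorem exists_eq_smul (h : IsWeaklyRegularFour f M) (x : Fin 4 → M)
    (hx : ∀ i j, f j • x i = f i • x j) : ∃ y, ∀ i, x i = f i • y := by
  obtain ⟨z, hz⟩ := h.exists_one (x 0) (x 1) (hx 0 1)
  refine ⟨z, fun i => sub_eq_zero.mp <| h.eq_zero _ ?_⟩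
  rw [smul_sub, ← hx 0 i, hz]
  module

/-- Exactness of the Koszul cochain complex in degree two. -/
theorem exists_eq_smul_sub_smul (h : IsWeaklyRegularFour f M) (x : Fin 4 → Fin 4 → M)
    (hx : ∀ i j l, i < j → j < l → f l • x i j - f j • x i l + f i • x j l = 0) :
    ∃ y : Fin 4 → M, ∀ i j, i < j → x i j = f j • y i - f i • y j := by
  have h012 := hx 0 1 2 (by decide) (by decide)
  have h013 := hx 0 1 3 (by decide) (by decide)
  have h023 := hx 0 2 3 (by decide) (by decide)
  obtain ⟨a, b, hab⟩ := h.exists_two (x 0 1) (-x 1 2) (x 0 2)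
    (by rw [← sub_eq_zero, ← h012]; module)
  have hk (k : Fin 4) (hk : f k • x 0 1 - f 1 • x 0 k + f 0 • x 1 k = 0) :
      ∃ c, x 0 k = f k • b - f 0 • c ∧ x 1 k = - f k • a - f 1 • c := by
    obtain ⟨c, hc⟩ := h.exists_one (f k • b - x 0 k) (-x 1 k - f k • a) (by
      rw [← sub_eq_zero, ← hk, hab]; module)
    refine ⟨c, by rw [← hc]; module, sub_eq_zero.mp <| h.eq_zero _ ?_⟩
    have e : f 0 • x 1 k = f 1 • x 0 k - f k • x 0 1 := by rw [← sub_eq_zero, ← hk]; module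
    have e' : x 0 k = f k • b - f 0 • c := by rw [← hc]; module
    rw [smul_sub, e, e', hab]; module
  obtain ⟨c, hc0, hc1⟩ := hk 2 h012
  obtain ⟨d, hd0, hd1⟩ := hk 3 h013
  have h23 : x 2 3 = f 3 • c - f 2 • d := sub_eq_zero.mp <| h.eq_zero _ (by
    have e : f 0 • x 2 3 = f 2 • x 0 3 - f 3 • x 0 2 := by rw [← sub_eq_zero, ← h023]; module
    rw [smul_sub, e, hc0, hd0]; module)
  refine ⟨![b, -a, c, d], fun i j hij => ?_⟩
  fin_cases i <;> fin_cases j <;> simp at hij ⊢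
  · rw [hab]; module
  · exact hc0
  · exact hd0
  · rw [hc1]; module
  · rw [hd1]; module
  · exact h23

/-- Exactness of the Koszul cochain complex in degree three. -/
theorem exists_eq_smul_sub_smul_add_smul (h : IsWeaklyRegularFour f M)
    (x : Fin 4 → Fin 4 → Fin 4 → M)
    (hx : f 3 • x 0 1 2 - f 2 • x 0 1 3 + f 1 • x 0 2 3 - f 0 • x 1 2 3 = 0) :
    ∃ y : Fin 4 → Fin 4 → M, ∀ i j l, i < j → j < l →
      x i j l = f l • y i j - f j • y i l + f i • y j l := by
  obtain ⟨a, b, c, habc⟩ := h.exists_three (x 0 1 2) (x 1 2 3) (-x 0 2 3) (x 0 1 3)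
    (by rw [← sub_eq_zero, ← hx]; module)
  obtain ⟨d, e, hde⟩ := h.exists_two (x 0 1 3 - f 3 • c) (f 3 • a - x 1 2 3)
    (f 3 • b + x 0 2 3) (by rw [← sub_eq_zero, ← neg_eq_zero, ← hx, habc]; module)
  have h013 : x 0 1 3 = f 3 • c + f 0 • d + f 1 • e := by
    rw [← sub_eq_zero, ← sub_eq_zero.mpr hde]; module
  obtain ⟨g, hg⟩ := h.exists_one (f 3 • b + x 0 2 3 - f 2 • e) (f 2 • d - f 3 • a + x 1 2 3) (by
    rw [← sub_eq_zero, ← hx, habc, h013]; module)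
  have h023 : x 0 2 3 = f 0 • g + f 2 • e - f 3 • b := by
    rw [← sub_eq_zero, ← sub_eq_zero.mpr hg]; module
  have h123 : x 1 2 3 = f 1 • g - f 2 • d + f 3 • a := sub_eq_zero.mp <| h.eq_zero _ (by
    have e' : f 0 • x 1 2 3 = f 3 • x 0 1 2 - f 2 • x 0 1 3 + f 1 • x 0 2 3 := by
      rw [← sub_eq_zero, ← neg_eq_zero, ← hx]; module
    rw [smul_sub, e', habc, h013, h023]; module)
  refine ⟨![![0, c, -b, -e], ![0, 0, a, d], ![0, 0, 0, g], 0], fun i j l hij hjl => ?_⟩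
  fin_cases i <;> fin_cases j <;> fin_cases l <;> simp at hij hjl ⊢
  · rw [habc]; module
  · rw [h013]; module
  · rw [h023]; module
  · rw [h123]; module

/-- A complex of modules of length four with a nullhomotopy for each element of a weakly regular
sequence of length four is exact next to its last term. -/
theorem mem_range_of_homotopy (f_reg : IsWeaklyRegularFour f M) {C₂ C₃ C₄ : Type*}
    [AddCommGroup C₂] [Module R C₂] [AddCommGroup C₃] [Module R C₃] [AddCommGroup C₄] [Module R C₄]
    (reg₂ : ∀ x : Fin 4 → C₂, (∀ i j, f j • x i = f i • x j) → ∃ y, ∀ i, x i = f i • y)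
    (reg₃ : IsWeaklyRegularFour f C₃)
    (reg₄ : IsWeaklyRegularFour f C₄)
    (d₂ : C₂ →ₗ[R] M) (d₃ : C₃ →ₗ[R] C₂) (d₄ : C₄ →ₗ[R] C₃)
    (h₁ : Fin 4 → M →ₗ[R] C₂) (h₂ : Fin 4 → C₂ →ₗ[R] C₃) (h₃ : Fin 4 → C₃ →ₗ[R] C₄)
    (d₂d₃ : ∀ x, d₂ (d₃ x) = 0) (d₃d₄ : ∀ x, d₃ (d₄ x) = 0)
    (H₂ : ∀ i x, f i • x = d₃ (h₂ i x) + h₁ i (d₂ x))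
    (H₃ : ∀ i x, f i • x = d₄ (h₃ i x) + h₂ i (d₃ x))
    (H₄ : ∀ i x, f i • x = h₃ i (d₄ x))
    (m : M) (hm : ∀ i, f i • m = d₂ (h₁ i m)) : ∃ c, d₂ c = m := by
  have e1 (i j) : d₃ (h₂ j (h₁ i m)) = f j • h₁ i m - f i • h₁ j m := by
    rw [H₂ j, ← hm i, map_smul]; abel
  have e2 (i j l) : d₄ (h₃ l (h₂ j (h₁ i m))) =
      f l • h₂ j (h₁ i m) - f j • h₂ l (h₁ i m) + f i • h₂ l (h₁ j m) := by
    rw [H₃ l, e1, map_sub, map_smul, map_smul]; abel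
  have e3 : f 3 • h₃ 2 (h₂ 1 (h₁ 0 m)) - f 2 • h₃ 3 (h₂ 1 (h₁ 0 m)) +
      f 1 • h₃ 3 (h₂ 2 (h₁ 0 m)) - f 0 • h₃ 3 (h₂ 2 (h₁ 1 m)) = 0 := by
    rw [H₄ 3, e2]; simp only [map_add, map_sub, map_smul]; abel
  obtain ⟨w, hw⟩ := reg₄.exists_eq_smul_sub_smul_add_smul
    (fun i j l => h₃ l (h₂ j (h₁ i m))) e3
  obtain ⟨v, hv⟩ := reg₃.exists_eq_smul_sub_smul (fun i j => h₂ j (h₁ i m) - d₄ (w i j)) (by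
    intro i j l hij hjl
    have := e2 i j l
    rw [hw i j l hij hjl] at this
    simp only [map_add, map_sub, map_smul] at this
    rw [← sub_eq_zero.mpr this.symm]
    module)
  have e4 (i j) (hij : i < j) :
      f j • (h₁ i m - d₃ (v i)) = f i • (h₁ j m - d₃ (v j)) := by
    have := congrArg d₃ (hv i j hij)
    simp only [map_sub, map_smul, e1, d₃d₄] at this
    rw [← sub_eq_zero, ← sub_eq_zero.mpr this]
    module
  obtain ⟨c, hc⟩ := reg₂ (fun i => h₁ i m - d₃ (v i)) (by
    intro i j
    rcases lt_trichotomy i j with hij | rfl | hij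
    · exact e4 i j hij
    · rfl
    · exact (e4 j i hij).symm)
  refine ⟨c, (sub_eq_zero.mp <| f_reg.eq_zero _ ?_).symm⟩
  have := congrArg d₂ (hc 0)
  simp only [map_sub, map_smul, d₂d₃] at this
  rw [smul_sub, hm, ← this]
  simp

end IsWeaklyRegularFour

section GulliksenNegard

variable {R n : Type*} [CommRing R] [Fintype n]

/-- The map `(ρ₀, ρ₁) ↦ tr ρ₀ - tr ρ₁`. -/
def traceSub : Matrix n n R × Matrix n n R →ₗ[R] R :=
  (Matrix.traceLinearMap n R R).comp (LinearMap.fst R _ _) -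
    (Matrix.traceLinearMap n R R).comp (LinearMap.snd R _ _)

theorem mem_ker_traceSub {p : Matrix n n R × Matrix n n R} :
    p ∈ LinearMap.ker (traceSub (R := R) (n := n)) ↔ p.1.trace = p.2.trace := by
  simp [traceSub, sub_eq_zero]

theorem Matrix.exists_eq_mul_sub_mul_of_trace_mul_adjugate_eq_zero [DecidableEq n]
    (A : Matrix n n R) (X : Fin 4 → Matrix n n R)
    (hX : IsWeaklyRegularFour (fun i => (A.adjugate * X i).trace) R)
    (γ : Matrix n n R) (hγ : (A.adjugate * γ).trace = 0) :
    ∃ ρ₀ ρ₁ : Matrix n n R, ρ₀.trace = ρ₁.trace ∧ γ = ρ₁ * A - A * ρ₀ := by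
  obtain ⟨P, hP⟩ := A.exists_isAdjugateDeriv
  have hM : IsWeaklyRegularFour (fun i => (A.adjugate * X i).trace) (Matrix n n R) := hX.pi.pi
  let L (M : Matrix n n R) : Matrix n n R →ₗ[R] Matrix n n R := LinearMap.mulLeft R M
  let S (M : Matrix n n R) : Matrix n n R →ₗ[R] Matrix n n R := LinearMap.mulRight R M
  let K := LinearMap.ker (traceSub (R := R) (n := n))
  let p₀ : K →ₗ[R] Matrix n n R := (LinearMap.fst R _ _).comp K.subtype
  let p₁ : K →ₗ[R] Matrix n n R := (LinearMap.snd R _ _).comp K.subtype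
  have hp (c : K) : (p₀ c).trace = (p₁ c).trace := mem_ker_traceSub.mp c.2
  let d₂ : K →ₗ[R] Matrix n n R := (S A).comp p₁ - (L A).comp p₀
  let s : R × Matrix n n R →ₗ[R] Matrix n n R :=
    (LinearMap.toSpanSingleton R (Matrix n n R) 1).comp (LinearMap.fst R _ _)
  let d₃ : R × Matrix n n R →ₗ[R] K := LinearMap.codRestrict K
    ((s + (S A).comp (LinearMap.snd R _ _)).prod (s + (L A).comp (LinearMap.snd R _ _))) (by
      intro c
      rw [mem_ker_traceSub]
      simp [S, L, Matrix.trace_mul_comm A])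
  let d₄ : R →ₗ[R] R × Matrix n n R :=
    (LinearMap.toSpanSingleton R R (-A.det)).prod
      (LinearMap.toSpanSingleton R (Matrix n n R) A.adjugate)
  let h₁ (i : Fin 4) : Matrix n n R →ₗ[R] K := LinearMap.codRestrict K
    ((-L (P (X i))).prod (-(L (X i)).comp P)) (by
      intro c
      rw [mem_ker_traceSub]
      simp [L, hP.trace_mul])
  let h₂ (i : Fin 4) : K →ₗ[R] R × Matrix n n R :=
    ((Matrix.traceLinearMap n R R).comp ((L (A.adjugate * X i)).comp p₀)).prod
      ((L (P (X i))).comp p₁ - P.comp ((L (X i)).comp p₀))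
  let h₃ (i : Fin 4) : R × Matrix n n R →ₗ[R] R :=
    (Matrix.traceLinearMap n R R).comp ((L (X i)).comp (LinearMap.snd R _ _))
  suffices ∃ c, d₂ c = γ by
    obtain ⟨c, hc⟩ := this
    exact ⟨p₀ c, p₁ c, hp c, hc.symm⟩
  refine hM.mem_range_of_homotopy (C₂ := K) (C₃ := R × Matrix n n R) (C₄ := R)
    ?_ (hX.prod hM) hX d₂ d₃ d₄ h₁ h₂ h₃ ?_ ?_ ?_ ?_ ?_ γ ?_
  · intro x hx
    obtain ⟨y, hy⟩ := (hM.prod hM).exists_eq_smul (fun i => (x i : Matrix n n R × Matrix n n R))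
      (fun i j => congrArg Subtype.val (hx i j))
    refine ⟨⟨y, hX.eq_zero _ ?_⟩, fun i => Subtype.ext (hy i)⟩
    rw [← map_smul, ← hy 0]
    exact (x 0).2
  · rintro ⟨r, κ⟩
    simp [d₂, d₃, p₀, p₁, S, L, s, add_mul, mul_add, mul_assoc]
  · intro r
    apply Subtype.ext
    simp [d₃, d₄, S, L, s, Matrix.adjugate_mul, Matrix.mul_adjugate, smul_smul]
  · intro i c
    have h1 := congrArg (· * p₁ c) (hP.mul_apply_add (X i))
    have h2 := congrArg (· * p₀ c) (hP.apply_mul_add (X i))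
    have h3 := hP.mul_apply_add (X i * p₀ c)
    have h4 := hP.apply_mul_add (X i * p₀ c)
    have h5 : P (d₂ c) = p₀ c * A.adjugate - A.adjugate * p₁ c := by
      change P (p₁ c * A - A * p₀ c) = _
      rw [map_sub, hP.apply_mul_left, hP.apply_mul_right, hp]
      simp only [sub_mul, mul_sub, Matrix.smul_mul, Matrix.mul_smul, one_mul, mul_one]
      abel
    simp only [add_mul, Matrix.smul_mul, one_mul, mul_assoc] at h1 h2 h3 h4
    apply Subtype.ext
    refine Prod.ext ?_ ?_
    · change (A.adjugate * X i).trace • p₀ c = (A.adjugate * X i * p₀ c).trace • 1 +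
        (P (X i) * p₁ c - P (X i * p₀ c)) * A + -(P (X i) * (p₁ c * A - A * p₀ c))
      rw [mul_assoc, ← h2, ← h4]
      noncomm_ring
    · change (A.adjugate * X i).trace • p₁ c = (A.adjugate * X i * p₀ c).trace • 1 +
        A * (P (X i) * p₁ c - P (X i * p₀ c)) + -(X i * P (d₂ c))
      rw [h5, mul_assoc A.adjugate, ← h1, ← h3]
      noncomm_ring
  · rintro i ⟨r, κ⟩
    refine Prod.ext ?_ ?_
    · change (A.adjugate * X i).trace • r = (X i * κ).trace • (-A.det) +
        (A.adjugate * X i * (r • 1 + κ * A)).trace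
      rw [mul_add, Matrix.trace_add, Matrix.trace_mul_comm (A.adjugate * X i) (κ * A)]
      have : κ * A * (A.adjugate * X i) = A.det • (κ * X i) := by
        rw [mul_assoc, ← mul_assoc A, Matrix.mul_adjugate]
        simp
      rw [this, Matrix.trace_smul, Matrix.trace_mul_comm κ]
      simp only [Matrix.mul_smul, mul_one, Matrix.trace_smul, smul_eq_mul]
      ring
    · change (A.adjugate * X i).trace • κ = (X i * κ).trace • A.adjugate +
        (P (X i) * (r • 1 + A * κ) - P (X i * (r • 1 + κ * A)))
      have h2 := congrArg (· * κ) (hP.apply_mul_add (X i))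
      simp only [add_mul, Matrix.smul_mul, one_mul] at h2
      rw [← h2, mul_add (X i), map_add, ← mul_assoc (X i), hP.apply_mul_right]
      simp only [mul_add, mul_sub, Matrix.mul_smul, mul_one, map_smul, mul_assoc]
      abel
  · intro i r
    change (A.adjugate * X i).trace • r = (X i * (r • A.adjugate)).trace
    rw [Matrix.mul_smul, Matrix.trace_smul, Matrix.trace_mul_comm, smul_eq_mul, smul_eq_mul,
      mul_comm]
  · intro i
    change (A.adjugate * X i).trace • γ = - (X i * P γ) * A - A * (-(P (X i) * γ))
    have h1 := congrArg (· * γ) (hP.mul_apply_add (X i))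
    have h2 := hP.apply_mul_add γ
    rw [hγ, zero_smul] at h2
    simp only [add_mul, Matrix.smul_mul, one_mul, mul_assoc] at h1
    rw [← h1, eq_neg_of_add_eq_zero_right h2]
    noncomm_ring

end GulliksenNegard

section Nagata

open Polynomial MvPolynomial Ideal Nat RingHom List

variable {k : Type*} [Field k] {n : ℕ} (f : MvPolynomial (Fin (n + 1)) k)
variable (v w : Fin (n + 1) →₀ ℕ)

namespace NagataAutomorphism

variable {f v} in
lemma lt_up (vlt : ∀ i, v i < 2 + f.totalDegree) : ∀ l ∈ ofFn v, l < 2 + f.totalDegree := by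
  grind

/-- We construct an algebra map `T1 f c` which maps `X_i` into `X_i + c • X_0 ^ r_i` when `i ≠ 0`
and `X_0` to `X_0`. -/
noncomputable abbrev T1 (c : k) :
    MvPolynomial (Fin (n + 1)) k →ₐ[k] MvPolynomial (Fin (n + 1)) k :=
  aeval fun i ↦ if i = 0 then X 0 else X i + c • X 0 ^ (2 + f.totalDegree) ^ (i : ℕ)

lemma t1_comp_t1_neg (c : k) : (T1 f c).comp (T1 f (-c)) = AlgHom.id _ _ := by
  rw [comp_aeval, ← MvPolynomial.aeval_X_left]
  ext i v
  cases i using Fin.cases <;> simp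

/-- `T1 f 1` leads to an algebra equiv `T f`. -/
noncomputable abbrev T := AlgEquiv.ofAlgHom (T1 f 1) (T1 f (-1))
  (t1_comp_t1_neg f 1) (by simpa using t1_comp_t1_neg f (-1))

lemma sum_r_mul_ne (vlt : ∀ i, v i < 2 + f.totalDegree) (wlt : ∀ i, w i < 2 + f.totalDegree)
    (ne : v ≠ w) : ∑ x : Fin (n + 1), (2 + f.totalDegree) ^ (x : ℕ) * v x ≠
      ∑ x : Fin (n + 1), (2 + f.totalDegree) ^ (x : ℕ) * w x := by
  intro h
  refine ne <| Finsupp.ext <| congrFun <| ofFn_inj.mp ?_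
  apply ofDigits_inj_of_len_eq (Nat.lt_add_right f.totalDegree one_lt_two)
    (by simp) (lt_up vlt) (lt_up wlt)
  simpa only [ofDigits_eq_sum_mapIdx, mapIdx_eq_ofFn, get_ofFn, length_ofFn,
    Fin.val_cast, mul_comm, sum_ofFn] using! h

lemma degreeOf_zero_t {a : k} (ha : a ≠ 0) : ((T f) (monomial v a)).degreeOf 0 =
    ∑ i : Fin (n + 1), (2 + f.totalDegree) ^ (i : ℕ) * v i := by
  rw [← natDegree_finSuccEquiv, monomial_eq, Finsupp.prod_pow v fun a ↦ X a]
  simp only [Fin.prod_univ_succ, Fin.sum_univ_succ, map_mul, map_prod, map_pow,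
    AlgEquiv.ofAlgHom_apply, MvPolynomial.aeval_C, MvPolynomial.aeval_X, if_pos, Fin.succ_ne_zero,
    ite_false, one_smul, map_add, finSuccEquiv_X_zero, finSuccEquiv_X_succ, algebraMap_eq]
  have h (i : Fin n) :
      (Polynomial.C (X (R := k) i) +
        Polynomial.X ^ (2 + f.totalDegree) ^ (i.succ : ℕ)) ^ v i.succ ≠ 0 :=
    pow_ne_zero (v i.succ) (leadingCoeff_ne_zero.mp <| by simp [add_comm, leadingCoeff_X_pow_add_C])
  rw [natDegree_mul (by simp [ha]) (mul_ne_zero (by simp) (Finset.prod_ne_zero_iff.mpr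
    (fun i _ ↦ h i))), natDegree_mul (by simp) (Finset.prod_ne_zero_iff.mpr (fun i _ ↦ h i)),
    natDegree_prod _ _ (fun i _ ↦ h i), natDegree_finSuccEquiv, degreeOf_C]
  simpa only [natDegree_pow, zero_add, natDegree_X, mul_one, Fin.val_zero, pow_zero, one_mul,
    add_right_inj] using Finset.sum_congr rfl (fun i _ ↦ by
    rw [add_comm (Polynomial.C _), natDegree_X_pow_add_C, mul_comm])

/-- `T` maps different monomials of `f` to polynomials with different degrees in `X_0`. -/
lemma degreeOf_t_ne_of_ne (hv : v ∈ f.support) (hw : w ∈ f.support) (ne : v ≠ w) :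
    (T f <| monomial v <| coeff v f).degreeOf 0 ≠
    (T f <| monomial w <| coeff w f).degreeOf 0 := by
  rw [degreeOf_zero_t _ _ <| mem_support_iff.mp hv, degreeOf_zero_t _ _ <| mem_support_iff.mp hw]
  refine sum_r_mul_ne f v w (fun i ↦ ?_) (fun i ↦ ?_) ne <;>
  exact lt_of_le_of_lt ((monomial_le_degreeOf i ‹_›).trans (degreeOf_le_totalDegree f i))
    (by lia)

lemma leadingCoeff_finSuccEquiv_t :
    (finSuccEquiv k n ((T f) ((monomial v) (coeff v f)))).leadingCoeff =
    algebraMap k _ (coeff v f) := by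
  rw [monomial_eq, Finsupp.prod_fintype]
  · simp only [map_mul, map_prod, leadingCoeff_mul, leadingCoeff_prod]
    rw [AlgEquiv.ofAlgHom_apply, algHom_C, algebraMap_eq, finSuccEquiv_apply,
      eval₂Hom_C, coe_comp]
    simp only [AlgEquiv.ofAlgHom_apply, Function.comp_apply, leadingCoeff_C, map_pow,
      leadingCoeff_pow, algebraMap_eq]
    have : ∀ j, ((finSuccEquiv k n) ((T1 f) 1 (X j))).leadingCoeff = 1 := fun j ↦ by
      by_cases h : j = 0
      · simp [h, finSuccEquiv_apply]
      · simp only [aeval_eq_bind₁, bind₁_X_right, if_neg h, one_smul, map_add, map_pow]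
        obtain ⟨i, rfl⟩ := Fin.exists_succ_eq.mpr h
        simp [finSuccEquiv_X_succ, finSuccEquiv_X_zero, add_comm]
    simp only [this, one_pow, Finset.prod_const_one, mul_one]
  exact fun i ↦ pow_zero _

/-- `T` maps `f` into some polynomial in `X_0` such that the leading coefficient is invertible. -/
lemma T_leadingcoeff_isUnit (fne : f ≠ 0) :
    IsUnit (finSuccEquiv k n (T f f)).leadingCoeff := by
  obtain ⟨v, vin, vs⟩ := Finset.exists_max_image f.support
    (fun v ↦ (T f ((monomial v) (coeff v f))).degreeOf 0) (support_nonempty.mpr fne)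
  set h := fun w ↦ (MvPolynomial.monomial w) (coeff w f)
  simp only [← natDegree_finSuccEquiv] at vs
  replace vs : ∀ x ∈ f.support \ {v}, (finSuccEquiv k n ((T f) (h x))).degree <
      (finSuccEquiv k n ((T f) (h v))).degree := by
    intro x hx
    obtain ⟨h1, h2⟩ := Finset.mem_sdiff.mp hx
    apply degree_lt_degree <| lt_of_le_of_ne (vs x h1) ?_
    simpa only [natDegree_finSuccEquiv]
      using degreeOf_t_ne_of_ne f _ _ h1 vin <| ne_of_not_mem_cons h2
  have coeff : (finSuccEquiv k n ((T f) (h v + ∑ x ∈ f.support \ {v}, h x))).leadingCoeff =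
      (finSuccEquiv k n ((T f) (h v))).leadingCoeff := by
    simp only [map_add, map_sum]
    rw [add_comm]
    apply leadingCoeff_add_of_degree_lt <| (lt_of_le_of_lt <| degree_sum_le _ _) ?_
    have h2 : h v ≠ 0 := by simpa [h] using mem_support_iff.mp vin
    replace h2 : (finSuccEquiv k n ((T f) (h v))) ≠ 0 := fun eq ↦ h2 <|
      by simpa only [map_eq_zero_iff _ (AlgEquiv.injective _)] using eq
    exact (Finset.sup_lt_iff <| Ne.bot_lt (fun x ↦ h2 <| degree_eq_bot.mp x)).mpr vs
  nth_rw 2 [← f.support_sum_monomial_coeff]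
  rw [Finset.sum_eq_add_sum_sdiff_singleton_of_mem vin h]
  rw [leadingCoeff_finSuccEquiv_t] at coeff
  simpa only [coeff, algebraMap_eq] using (mem_support_iff.mp vin).isUnit.map MvPolynomial.C

end NagataAutomorphism

end Nagata

theorem MvPolynomial.exists_algEquiv_polynomial_isUnit_leadingCoeff {k : Type*} [Field k] {n : ℕ}
    {f : MvPolynomial (Fin (n + 1)) k} (hf : f ≠ 0) :
    ∃ e : MvPolynomial (Fin (n + 1)) k ≃ₐ[k] Polynomial (MvPolynomial (Fin n) k),
      IsUnit (e f).leadingCoeff :=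
  ⟨(NagataAutomorphism.T f).trans (finSuccEquiv k n),
    NagataAutomorphism.T_leadingcoeff_isUnit f hf⟩
section Grade

open RingTheory.Sequence

attribute [local instance] Polynomial.algebra Polynomial.isLocalization in
theorem Polynomial.height_le_one_of_comap_C_eq_bot {D : Type*} [CommRing D] [IsDomain D]
    (P : Ideal (Polynomial D)) [P.IsPrime] (h : P.comap Polynomial.C = ⊥) : P.height ≤ 1 := by
  let K := FractionRing D
  have disj :
      Disjoint ((nonZeroDivisors D).map (Polynomial.C (R := D)) : Set (Polynomial D)) P := by
    refine Set.disjoint_left.mpr ?_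
    rintro _ ⟨b, hb, rfl⟩ hP
    have : b ∈ P.comap Polynomial.C := hP
    rw [h, Ideal.mem_bot] at this
    exact nonZeroDivisors.ne_zero hb this
  rw [← IsLocalization.height_map_of_disjoint (S := Polynomial K) _ P disj]
  have := IsLocalization.isPrime_of_isPrime_disjoint _ (Polynomial K) P ‹_› disj
  have h1 := Ideal.height_le_ringKrullDim_of_isPrime (I := P.map (algebraMap _ (Polynomial K)))
  rw [Polynomial.ringKrullDim_of_isNoetherianRing, ringKrullDim_eq_zero_of_field, zero_add] at h1
  exact_mod_cast h1

theorem Polynomial.height_le_height_comap_C_add_one {B : Type*} [CommRing B] [IsNoetherianRing B]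
    (P : Ideal (Polynomial B)) [P.IsPrime] : P.height ≤ (P.comap Polynomial.C).height + 1 := by
  let p := P.comap (Polynomial.C (R := B))
  have : P.LiesOver p := ⟨rfl⟩
  refine (Ideal.height_le_height_add_of_liesOver p P).trans (add_le_add_right ?_ _)
  let e := p.polynomialQuotientEquivQuotientPolynomial.symm
  have hcomp : e.toRingHom.comp (Ideal.Quotient.mk (p.map (algebraMap B (Polynomial B)))) =
      Polynomial.mapRingHom (Ideal.Quotient.mk p) :=
    RingHom.ext fun f => p.polynomialQuotientEquivQuotientPolynomial_symm_mk f
  have he : (P.map (Ideal.Quotient.mk (p.map (algebraMap B (Polynomial B))))).map e =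
      P.map (Polynomial.mapRingHom (Ideal.Quotient.mk p)) := by
    rw [← hcomp, ← Ideal.map_map]
    rfl
  rw [← e.height_map, he]
  have hsurj : Function.Surjective (Polynomial.mapRingHom (Ideal.Quotient.mk p)) :=
    Polynomial.map_surjective _ Ideal.Quotient.mk_surjective
  have hker : RingHom.ker (Polynomial.mapRingHom (Ideal.Quotient.mk p)) ≤ P := by
    rw [Polynomial.ker_mapRingHom, Ideal.mk_ker, Ideal.map_le_iff_le_comap]
  have := Ideal.map_isPrime_of_surjective hsurj hker
  refine Polynomial.height_le_one_of_comap_C_eq_bot _ (eq_bot_iff.mpr fun b hb => ?_)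
  obtain ⟨b, rfl⟩ := Ideal.Quotient.mk_surjective b
  obtain ⟨q, hq, hqb⟩ := (Ideal.mem_map_iff_of_surjective _ hsurj).mp hb
  have h : q - Polynomial.C b ∈ P := hker (by simpa [RingHom.mem_ker, sub_eq_zero] using hqb)
  rw [Ideal.mem_bot, Ideal.Quotient.eq_zero_iff_mem]
  exact (Submodule.sub_mem_iff_right _ hq).mp h

theorem Polynomial.le_height_comap_C {B : Type*} [CommRing B] [IsNoetherianRing B]
    {J : Ideal (Polynomial B)} {g : Polynomial B} (hg : g.Monic) (hgJ : g ∈ J) {r : ℕ}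
    (hJ : (r + 1 : ℕ) ≤ J.height) : (r : ℕ∞) ≤ (J.comap Polynomial.C).height := by
  rw [Ideal.height_eq_inf_minimalPrimes]
  refine le_iInf₂ fun p hp => ?_
  have := hp.1.1
  have hint : Algebra.IsIntegral B (Polynomial B ⧸ J) := ⟨hg.quotient_isIntegral hgJ⟩
  obtain ⟨Q, -, hQ, hQp⟩ := Ideal.exists_ideal_over_prime_of_isIntegral (S := Polynomial B ⧸ J) p ⊥
    (by
      intro x hx
      exact hp.1.2 (Ideal.Quotient.eq_zero_iff_mem (I := J).mp hx))
  have hQ' := Ideal.comap_isPrime (Ideal.Quotient.mk J) Q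
  have h1 := Polynomial.height_le_height_comap_C_add_one (Q.comap (Ideal.Quotient.mk J))
  have h2 : (Q.comap (Ideal.Quotient.mk J)).comap Polynomial.C = p := hQp
  rw [h2] at h1
  have h3 : J ≤ Q.comap (Ideal.Quotient.mk J) := fun x hx => by
    rw [Ideal.mem_comap, Ideal.Quotient.eq_zero_iff_mem.mpr hx]
    exact Q.zero_mem
  have h4 := (hJ.trans (Ideal.height_mono h3)).trans h1
  push_cast at h4
  exact (ENat.add_le_add_iff_right (by simp)).mp h4

theorem Polynomial.Monic.isSMulRegular_quotient {B : Type*} [CommRing B]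
    {g : Polynomial B} (hg : g.Monic) (I : Ideal B) :
    IsSMulRegular (Polynomial B ⧸ I.map (Polynomial.C (R := B))) g := by
  refine isSMulRegular_iff_right_eq_zero_of_smul.mpr fun x hx => ?_
  obtain ⟨q, rfl⟩ := Ideal.Quotient.mk_surjective x
  have h1 : g * q ∈ I.map (Polynomial.C (R := B)) := Ideal.Quotient.eq_zero_iff_mem.mp hx
  have h2 : I.map (Polynomial.C (R := B)) =
      RingHom.ker (Polynomial.mapRingHom (Ideal.Quotient.mk I)) := by
    rw [Polynomial.ker_mapRingHom, Ideal.mk_ker]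
  rw [Ideal.Quotient.eq_zero_iff_mem, h2, RingHom.mem_ker]
  rw [h2, RingHom.mem_ker, map_mul] at h1
  exact ((hg.map (Ideal.Quotient.mk I)).mul_right_eq_zero_iff).mp h1

theorem RingEquiv.isWeaklyRegular_map {R S : Type*} [CommRing R] [CommRing S] (e : R ≃+* S)
    {rs : List R} (h : IsWeaklyRegular R rs) : IsWeaklyRegular S (rs.map e) :=
  (e.toAddEquiv.isWeaklyRegular_congr <| List.forall₂_map_right_iff.mpr <|
    List.forall₂_same.mpr fun r _ x => e.map_mul r x).mp h

theorem isWeaklyRegular_replicate_one {R : Type*} [CommRing R] (r : ℕ) :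
    IsWeaklyRegular R (List.replicate r (1 : R)) := by
  refine ⟨fun i h => ?_⟩
  simp

theorem MvPolynomial.exists_isWeaklyRegular_of_le_height {k : Type*} [Field k] (n r : ℕ)
    (I : Ideal (MvPolynomial (Fin n) k)) (hI : r ≤ I.height) :
    ∃ rs : List (MvPolynomial (Fin n) k),
      rs.length = r ∧ (∀ f ∈ rs, f ∈ I) ∧ IsWeaklyRegular (MvPolynomial (Fin n) k) rs := by
  induction n generalizing r with
  | zero =>
    by_cases htop : I = ⊤
    · exact ⟨List.replicate r 1, by simp, by simp [htop], isWeaklyRegular_replicate_one r⟩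
    have h := Ideal.height_le_ringKrullDim_of_ne_top htop
    rw [MvPolynomial.ringKrullDim_of_isNoetherianRing, ringKrullDim_eq_zero_of_field,
      Nat.card_eq_zero.mpr (Or.inl inferInstance)] at h
    have h0 : I.height ≤ 0 := by exact_mod_cast h
    have hr : r = 0 := by exact_mod_cast nonpos_iff_eq_zero.mp (hI.trans h0)
    exact ⟨[], by simp [hr]⟩
  | succ n ih =>
    obtain _ | r := r
    · exact ⟨[], by simp⟩
    have hbot : I ≠ ⊥ := by
      rintro rfl
      simp at hI
    obtain ⟨f, hfI, hf⟩ := Submodule.exists_mem_ne_zero_of_ne_bot hbot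
    obtain ⟨e, he⟩ := MvPolynomial.exists_algEquiv_polynomial_isUnit_leadingCoeff hf
    let J := I.map e.toRingEquiv
    have hmem {p : Polynomial (MvPolynomial (Fin n) k)} (hp : p ∈ J) : e.symm p ∈ I := by
      obtain ⟨x, hx, rfl⟩ := (Ideal.mem_map_of_equiv e.toRingEquiv p).mp hp
      simpa using hx
    let g : Polynomial (MvPolynomial (Fin n) k) := he.unit⁻¹ • e f
    have hg : g.Monic := Polynomial.monic_of_isUnit_leadingCoeff_inv_smul he
    have hgJ : g ∈ J := Submodule.smul_of_tower_mem _ he.unit⁻¹.val (Ideal.mem_map_of_mem _ hfI)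
    obtain ⟨rs, hlen, hrs, hreg⟩ := ih r (J.comap Polynomial.C)
      (Polynomial.le_height_comap_C hg hgJ (by rwa [e.toRingEquiv.height_map]))
    refine ⟨(rs.map Polynomial.C ++ [g]).map e.toRingEquiv.symm, by simp [hlen], ?_,
      e.toRingEquiv.symm.isWeaklyRegular_map ?_⟩
    · intro x hx
      obtain ⟨p, hp, rfl⟩ := List.mem_map.mp hx
      refine hmem ?_
      obtain hp | hp := List.mem_append.mp hp
      · obtain ⟨b, hb, rfl⟩ := List.mem_map.mp hp
        exact hrs b hb
      · rwa [List.mem_singleton.mp hp]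
    · rw [isWeaklyRegular_append_iff, isWeaklyRegular_singleton_iff]
      refine ⟨hreg.of_flat, ?_⟩
      rw [smul_eq_mul, Ideal.mul_top, ← Ideal.map_ofList]
      exact hg.isSMulRegular_quotient _

end Grade

section Assembly

open RingTheory.Sequence

theorem RingTheory.Sequence.IsWeaklyRegular.mem_ofList_take {R : Type*} [CommRing R] {rs : List R}
    (h : IsWeaklyRegular R rs) (i : ℕ) (hi : i < rs.length) (x : R)
    (hx : rs[i] * x ∈ Ideal.ofList (rs.take i)) : x ∈ Ideal.ofList (rs.take i) := by
  have h1 := h.regular_mod_prev i hi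
  rw [smul_eq_mul, Ideal.mul_top] at h1
  exact Ideal.Quotient.eq_zero_iff_mem.mp
    (isSMulRegular_iff_right_eq_zero_of_smul.mp h1 (Ideal.Quotient.mk _ x)
      (Ideal.Quotient.eq_zero_iff_mem.mpr hx))

theorem RingTheory.Sequence.IsWeaklyRegular.isWeaklyRegularFour {R : Type*} [CommRing R]
    {f : Fin 4 → R} (h : IsWeaklyRegular R (List.ofFn f)) : IsWeaklyRegularFour f R where
  eq_zero x hx := by
    simpa using h.mem_ofList_take 0 (by simp) x (by simpa using hx)
  exists_one x y hx := by
    have := h.mem_ofList_take 1 (by simp) x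
    simp only [List.ofFn_succ, List.take, List.getElem_cons_succ, List.getElem_cons_zero,
      Ideal.ofList_cons, Ideal.ofList_nil, sup_bot_eq, Ideal.mem_span_singleton] at this
    exact this ⟨y, by simpa using hx⟩
  exists_two x y₀ y₁ hx := by
    have := h.mem_ofList_take 2 (by simp) x
    simp only [List.ofFn_succ, List.take, List.getElem_cons_succ, List.getElem_cons_zero,
      Ideal.ofList_cons, Ideal.ofList_nil, sup_bot_eq, Submodule.mem_sup, exists_exists_eq_and,
      Ideal.mem_span_singleton'] at this
    obtain ⟨z₀, z₁, hz⟩ := this ⟨y₀, y₁, by simpa [mul_comm] using hx.symm⟩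
    exact ⟨z₀, z₁, by simpa [mul_comm] using hz.symm⟩
  exists_three x y₀ y₁ y₂ hx := by
    have := h.mem_ofList_take 3 (by simp) x
    simp only [List.ofFn_succ, List.take, List.getElem_cons_succ, List.getElem_cons_zero,
      Ideal.ofList_cons, Ideal.ofList_nil, sup_bot_eq, Submodule.mem_sup, exists_exists_eq_and,
      Ideal.mem_span_singleton'] at this
    obtain ⟨z₀, _, ⟨z₁, z₂, rfl⟩, hz⟩ :=
      this ⟨y₀, _, ⟨y₁, y₂, rfl⟩, by simpa [mul_comm, add_assoc] using hx.symm⟩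
    exact ⟨z₀, z₁, z₂, by simpa [mul_comm, add_assoc] using hz.symm⟩

theorem idealCodim_eq_height {R : Type*} [CommRing R] (I : Ideal R) : idealCodim I = I.height := by
  rw [idealCodim, Ideal.height]
  refine le_antisymm (le_iInf₂ fun p hp => ?_) (le_iInf₂ fun P hP => ?_)
  · have := hp.1.1
    exact iInf₂_le_of_le ⟨p, this⟩ hp le_rfl
  · exact iInf₂_le_of_le P.asIdeal hP le_rfl

theorem Matrix.range_trace_mul_adjugate {R : Type*} [CommRing R] {t : ℕ}
    (A : Matrix (Fin (t + 1)) (Fin (t + 1)) R) :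
    LinearMap.range ((Matrix.traceLinearMap (Fin (t + 1)) R R).comp
      (LinearMap.mulRight R A.adjugate)) =
    Ideal.span {d | ∃ r c : Fin (t + 1), d = (A.submatrix r.succAbove c.succAbove).det} := by
  apply le_antisymm
  · rintro _ ⟨γ, rfl⟩
    change (γ * A.adjugate).trace ∈ _
    rw [Matrix.trace]
    refine Ideal.sum_mem _ fun i _ => ?_
    rw [Matrix.diag_apply, Matrix.mul_apply]
    refine Ideal.sum_mem _ fun j _ => Ideal.mul_mem_left _ _ ?_
    rw [Matrix.adjugate_fin_succ_eq_det_submatrix]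
    exact Ideal.mul_mem_left _ _ (Ideal.subset_span ⟨_, _, rfl⟩)
  · rw [Ideal.span, Submodule.span_le]
    rintro _ ⟨r, c, rfl⟩
    refine ⟨Matrix.single r c ((-1) ^ (r + c : ℕ)), ?_⟩
    change (Matrix.single r c _ * A.adjugate).trace = _
    rw [Matrix.trace_single_mul, Matrix.adjugate_fin_succ_eq_det_submatrix, smul_eq_mul,
      ← mul_assoc, ← pow_add, Even.neg_one_pow ⟨_, rfl⟩, one_mul]

end Assembly

/-- exactness of the tail of the Gulliksen–Negård complex:
for a `(t+1) × (t+1)` homogeneous matrix `A` inducing `φ : F → G`, with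
`I_A = I_t(A)` of codimension 4, the sequence
`ker(Hom(F,F) ⊕ Hom(G,G) → R) → Hom(F,G) → I_A(s) → 0` is exact, where the
first map is `(ρ₀, ρ₁) ↦ ρ₁ φ - φ ρ₀` (restricted to pairs with equal traces),
and the second map is `γ ↦ tr(γ ψ)` with `ψ` the adjugate of `A`. -/
theorem stmt12 (k : Type*) [Field k] [CharZero k] (n t : ℕ)
    (a b : Fin (t + 1) → ℤ)
    (A : Matrix (Fin (t + 1)) (Fin (t + 1)) (MvPolynomial (Fin (n + 1)) k))
    (hA : ∀ j i, IsHomogZ (A j i) (a j - b i))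
    (IA : Ideal (MvPolynomial (Fin (n + 1)) k))
    (hIA : IA = Ideal.span
      {d | ∃ r c : Fin (t + 1), d = (A.submatrix r.succAbove c.succAbove).det})
    (hcodim : idealCodim IA = 4) :
    (∀ γ : Matrix (Fin (t + 1)) (Fin (t + 1)) (MvPolynomial (Fin (n + 1)) k),
        (γ * A.adjugate).trace ∈ IA) ∧
    (∀ x ∈ IA, ∃ γ : Matrix (Fin (t + 1)) (Fin (t + 1)) (MvPolynomial (Fin (n + 1)) k),
        (γ * A.adjugate).trace = x) ∧
    (∀ γ : Matrix (Fin (t + 1)) (Fin (t + 1)) (MvPolynomial (Fin (n + 1)) k),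
        (γ * A.adjugate).trace = 0 ↔
          ∃ ρ₀ ρ₁ : Matrix (Fin (t + 1)) (Fin (t + 1)) (MvPolynomial (Fin (n + 1)) k),
            ρ₀.trace = ρ₁.trace ∧ γ = ρ₁ * A - A * ρ₀) := by
  have hrange := A.range_trace_mul_adjugate
  rw [← hIA] at hrange
  have hsurj : ∀ x ∈ IA, ∃ γ : Matrix (Fin (t + 1)) (Fin (t + 1)) (MvPolynomial (Fin (n + 1)) k),
      (γ * A.adjugate).trace = x := by
    intro x hx
    rw [← hrange] at hx
    exact hx
  refine ⟨fun γ => hrange.le ⟨γ, rfl⟩, hsurj, fun γ => ⟨fun hγ => ?_, ?_⟩⟩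
  · obtain ⟨rs, hlen, hmem, hreg⟩ := MvPolynomial.exists_isWeaklyRegular_of_le_height (n + 1) 4 IA
      (by rw [← idealCodim_eq_height, hcodim]; rfl)
    have hX (i : Fin 4) : ∃ X : Matrix (Fin (t + 1)) (Fin (t + 1)) (MvPolynomial (Fin (n + 1)) k),
        (A.adjugate * X).trace = rs[i] := by
      obtain ⟨X, hX⟩ := hsurj rs[i] (hmem _ (List.getElem_mem _))
      exact ⟨X, by rw [Matrix.trace_mul_comm, hX]⟩
    choose X hX using hX
    refine A.exists_eq_mul_sub_mul_of_trace_mul_adjugate_eq_zero X ?_ γ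
      (by rw [Matrix.trace_mul_comm, hγ])
    apply RingTheory.Sequence.IsWeaklyRegular.isWeaklyRegularFour
    have hofFn : List.ofFn (fun i => (A.adjugate * X i).trace) = rs := by
      refine List.ext_getElem (by simp [hlen]) fun i h₁ h₂ => ?_
      rw [List.getElem_ofFn, hX]
      rfl
    rwa [hofFn]
  · rintro ⟨ρ₀, ρ₁, hρ, rfl⟩
    rw [sub_mul, mul_assoc, Matrix.mul_adjugate, Matrix.trace_sub, mul_assoc,
      Matrix.trace_mul_comm A, mul_assoc, Matrix.adjugate_mul]
    simp [hρ]
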